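/- arXiv:2605.16478 — 7 statements merged into one kernel-verified Lean document; each statement's English description precedes it below -/
import Mathlib

section
/- Let G be a finite abelian group and A a multiset of cardinality |G| with elements in G. Then A is quotient-realizable in G if and only if the product (with multiplicity) of all elements of A equals 1 (Hall's theorem, written multiplicatively). -/
/-- A multiset `A` of cardinality `|G|` with elements in a finite group `G` is
quotient-realizable in `G` if there are bijections `b, c : {1,…,|G|} → G` with
`A = {b(i)·c(i)⁻¹ : 1 ≤ i ≤ |G|}` as multisets. -/
def QuotientRealizable (G : Type*) [Group G] (A : Multiset G) : Prop :=
  ∃ b c : Fin (Nat.card G) ≃ G,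
    A = ↑(List.ofFn fun i => b i * (c i)⁻¹)

/-- Two distinct points are separated by a set that is invariant under `σ` or under
`σ * swap x y`. -/
theorem exists_invariant_set_separating {α : Type*} [Finite α] [DecidableEq α]
    (σ : Equiv.Perm α) {x y : α} (hxy : x ≠ y) :
    ∃ R : Set α, (x ∉ R ∧ y ∈ R ∨ x ∈ R ∧ y ∉ R) ∧
      ((∀ g, σ g ∈ R ↔ g ∈ R) ∨ ∀ g, (σ * Equiv.swap x y) g ∈ R ↔ g ∈ R) := by
  have invariant : ∀ (τ : Equiv.Perm α) (R : Set α), (∀ g ∈ R, τ g ∈ R) →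
      ∀ g, τ g ∈ R ↔ g ∈ R := by
    intro τ R h g
    refine ⟨fun hg => ?_, h g⟩
    have himage : Set.image τ R = R := Set.eq_of_subset_of_ncard_le (Set.image_subset_iff.2 h)
      (Set.ncard_image_of_injective R τ.injective).ge
    obtain ⟨a, ha, hag⟩ := himage.ge hg
    rwa [← τ.injective hag]
  have hex : ∃ m, 0 < m ∧ ((σ ^ m) x = x ∨ (σ ^ m) x = y) :=
    ⟨orderOf σ, orderOf_pos σ, Or.inl (by simp [pow_orderOf_eq_one])⟩
  classical
  obtain ⟨hm, hmx⟩ := Nat.find_spec hex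
  have hmin := fun k (hk : k < Nat.find hex) => Nat.find_min hex hk
  set m := Nat.find hex
  have step : ∀ k, σ ((σ ^ k) x) = (σ ^ (k + 1)) x := fun k => by
    rw [pow_succ', Equiv.Perm.mul_apply]
  refine ⟨{g | ∃ k, 0 < k ∧ k ≤ m ∧ (σ ^ k) x = g}, ?_, ?_⟩
  · rcases hmx with h | h
    · refine Or.inr ⟨⟨m, hm, le_rfl, h⟩, ?_⟩
      rintro ⟨k, hk, hkm, hky⟩
      rcases hkm.lt_or_eq with hlt | rfl
      · exact hmin k hlt ⟨hk, Or.inr hky⟩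
      · exact hxy (h.symm.trans hky)
    · refine Or.inl ⟨?_, ⟨m, hm, le_rfl, h⟩⟩
      rintro ⟨k, hk, hkm, hky⟩
      rcases hkm.lt_or_eq with hlt | rfl
      · exact hmin k hlt ⟨hk, Or.inl hky⟩
      · exact hxy (hky.symm.trans h)
  · rcases hmx with h | h
    · refine Or.inl (invariant _ _ ?_)
      rintro g ⟨k, hk, hkm, rfl⟩
      rcases hkm.lt_or_eq with hlt | rfl
      · exact ⟨k + 1, by omega, hlt, (step k).symm⟩
      · exact ⟨1, one_pos, hm, by rw [h, pow_one]⟩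
    · refine Or.inr (invariant _ _ ?_)
      rintro g ⟨k, hk, hkm, rfl⟩
      rw [Equiv.Perm.mul_apply]
      rcases hkm.lt_or_eq with hlt | rfl
      · rw [Equiv.swap_apply_of_ne_of_ne (fun e => hmin k hlt ⟨hk, Or.inl e⟩)
          (fun e => hmin k hlt ⟨hk, Or.inr e⟩)]
        exact ⟨k + 1, by omega, hlt, (step k).symm⟩
      · exact ⟨1, one_pos, hm, by rw [h, Equiv.swap_apply_right, pow_one]⟩

/-- Exchanging the values of two bijections `e`, `e'` at the indices whose `e`-value lies in `R`
gives an injection, provided `e` and `e'` take values in `R` at the same indices. -/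
theorem injective_ite_mem_of_mem_iff {ι α : Type*} (e e' : ι ≃ α) (R : Set α)
    [DecidablePred (· ∈ R)] (h : ∀ i, e' i ∈ R ↔ e i ∈ R) :
    Function.Injective fun i => if e i ∈ R then e' i else e i := by
  intro i j hij
  have hi := h i
  have hj := h j
  dsimp only at hij
  split_ifs at hij with h1 h2 h2
  · exact e'.injective hij
  · rw [hij] at hi; tauto
  · rw [← hij] at hj; tauto
  · exact e.injective hij

/-- Modifying a sequence of quotients of two enumerations at two places, without changing its
product, gives again a sequence of quotients, provided an invariant set separates the two
places. -/
theorem exists_equiv_div_eq_of_invariant_set {ι G : Type*} [Finite ι] [CommGroup G]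
    (b c : ι ≃ G) (a : ι → G) {p q : ι} (hpq : p ≠ q)
    (ha : ∀ i, i ≠ p → i ≠ q → b i / c i = a i)
    (hprod : a p * a q = (b p / c p) * (b q / c q)) (R : Set G)
    (hR : ∀ i, (b p * b q / a q) / c i ∈ R ↔ b i ∈ R) (hp : b p ∉ R) (hq : b q ∈ R) :
    ∃ b' c' : ι ≃ G, ∀ i, b' i / c' i = a i := by
  classical
  have : Finite G := Finite.of_equiv ι b
  set T := b p * b q / a q with hT
  let e : ι ≃ G := c.trans (Equiv.divLeft T)
  have he : ∀ i, e i = T / c i := fun i => rfl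
  have bijective : ∀ f : ι → G, Function.Injective f → Function.Bijective f := fun f hf =>
    hf.bijective_of_nat_card_le (Nat.card_congr b).ge
  let f : ι ≃ G := Equiv.ofBijective _ (bijective _ (injective_ite_mem_of_mem_iff b e R hR))
  let g : ι ≃ G := Equiv.ofBijective _
    (bijective _ (injective_ite_mem_of_mem_iff e b R fun i => (hR i).symm))
  have hf : ∀ i, f i = if b i ∈ R then e i else b i := fun i => rfl
  have hg : ∀ i, g i = if b i ∈ R then b i else e i := fun i => if_congr (hR i) rfl rfl
  refine ⟨(Equiv.swap p q).trans f, g.trans (Equiv.divLeft T), fun i => ?_⟩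
  simp only [Equiv.trans_apply, Equiv.divLeft_apply]
  by_cases hiq : i = q
  · subst hiq
    rw [Equiv.swap_apply_right, hf, hg, if_neg hp, if_pos hq, hT]
    simp [div_eq_mul_inv, mul_comm, mul_left_comm]
  by_cases hip : i = p
  · subst hip
    rw [Equiv.swap_apply_left, hf, hg, if_pos hq, if_neg hp, he, he, div_div_cancel,
      eq_div_of_mul_eq' hprod, hT]
    simp only [div_eq_mul_inv]
    ac_rfl
  · rw [Equiv.swap_apply_of_ne_of_ne hip hiq, hf, hg, ← ha i hip hiq, he]
    split_ifs <;> simp [div_eq_mul_inv, mul_comm, mul_left_comm]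

/-- Modifying a sequence of quotients of two enumerations at two places, without changing its
product, gives again a sequence of quotients. -/
theorem exists_equiv_div_eq_of_mul_eq {ι G : Type*} [Finite ι] [CommGroup G]
    (b c : ι ≃ G) (a : ι → G) {p q : ι} (hpq : p ≠ q)
    (ha : ∀ i, i ≠ p → i ≠ q → b i / c i = a i)
    (hprod : a p * a q = (b p / c p) * (b q / c q)) :
    ∃ b' c' : ι ≃ G, ∀ i, b' i / c' i = a i := by
  classical
  have : Finite G := Finite.of_equiv ι b
  set T := b p * b q / a q with hT
  let σ : Equiv.Perm G := b.symm.trans (c.trans (Equiv.divLeft T))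
  have hσ : ∀ i, σ (b i) = T / c i := fun i => by simp [σ]
  obtain ⟨R, hsep, hinv⟩ := exists_invariant_set_separating σ (b.injective.ne hpq)
  wlog hR : b p ∉ R ∧ b q ∈ R generalizing R
  · refine this Rᶜ ?_ ?_ ?_
    · simpa only [Set.mem_compl_iff, not_not, or_comm] using hsep.symm
    · simpa only [Set.mem_compl_iff, not_iff_not] using hinv
    · simpa using hsep.resolve_left hR
  obtain ⟨hp, hq⟩ := hR
  rcases hinv with hinv | hinv
  · exact exists_equiv_div_eq_of_invariant_set b c a hpq ha hprod R
      (fun i => by rw [← hT, ← hσ]; exact hinv _) hp hq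
  · -- Pair `b p` with `c q` and `b q` with `c p`: this replaces `σ` by `σ * swap (b p) (b q)`.
    refine exists_equiv_div_eq_of_invariant_set b ((Equiv.swap p q).trans c) a hpq ?_ ?_ R ?_ hp hq
    · intro i hip hiq
      rw [Equiv.trans_apply, Equiv.swap_apply_of_ne_of_ne hip hiq, ha i hip hiq]
    · rw [hprod]
      simp only [Equiv.trans_apply, Equiv.swap_apply_left, Equiv.swap_apply_right]
      simp only [div_eq_mul_inv]
      ac_rfl
    · intro i
      rw [← hT, Equiv.trans_apply, ← hσ, ← hinv (b i), Equiv.Perm.mul_apply,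
        b.injective.swap_apply]

/-- Hall's theorem for sequences: a sequence with product `1`, indexed by a type in bijection
with `G`, is the sequence of quotients of two enumerations of `G`. -/
theorem exists_equiv_div_eq_of_prod_eq_one {ι G : Type*} [Fintype ι] [CommGroup G]
    (e : ι ≃ G) (a : ι → G) (ha : ∏ i, a i = 1) :
    ∃ b c : ι ≃ G, ∀ i, b i / c i = a i := by
  classical
  suffices H : ∀ (s : Finset ι) (a : ι → G), (∀ i ∉ s, a i = 1) → ∏ i ∈ s, a i = 1 →
      ∃ b c : ι ≃ G, ∀ i, b i / c i = a i from H Finset.univ a (by simp) ha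
  intro s
  induction s using Finset.induction_on with
  | empty => exact fun a h _ => ⟨e, e, fun i => by simp [h i]⟩
  | insert q s hqs ih =>
    intro a h1 hprod
    rw [Finset.prod_insert hqs] at hprod
    rcases s.eq_empty_or_nonempty with rfl | ⟨p, hp⟩
    · refine ⟨e, e, fun i => ?_⟩
      by_cases hi : i = q
      · subst hi; simpa using hprod.symm
      · rw [div_self', h1 i (by simpa using hi)]
    · have hpq : p ≠ q := fun h => hqs (h ▸ hp)
      obtain ⟨b, c, hbc⟩ := ih (Function.update (Function.update a q 1) p (a p * a q))
        (by
          intro i hi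
          rw [Function.update_of_ne (ne_of_mem_of_not_mem hp hi).symm]
          by_cases hiq : i = q
          · rw [hiq, Function.update_self]
          · rw [Function.update_of_ne hiq, h1 i (by simp [hi, hiq])])
        (by
          rw [Finset.prod_update_of_mem hp, ← hprod,
            Finset.prod_congr rfl (g := a) fun i hi => Function.update_of_ne
              (ne_of_mem_of_not_mem (Finset.mem_sdiff.1 hi).1 hqs) _ _,
            ← Finset.mul_prod_erase s a hp, Finset.sdiff_singleton_eq_erase]
          ac_rfl)
      refine exists_equiv_div_eq_of_mul_eq b c a hpq (fun i hip hiq => ?_) ?_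
      · rw [hbc, Function.update_of_ne hip, Function.update_of_ne hiq]
      · rw [hbc, hbc, Function.update_self, Function.update_of_ne hpq.symm,
          Function.update_self, mul_one]

/-- Hall's theorem, written multiplicatively: in a finite abelian group,
a multiset of cardinality `|G|` is quotient-realizable iff its product is `1`. -/
theorem stmt2 {G : Type*} [CommGroup G] [Finite G] (A : Multiset G)
    (hA : Multiset.card A = Nat.card G) :
    QuotientRealizable G A ↔ A.prod = 1 := by
  constructor
  · rintro ⟨b, c, rfl⟩
    have := Fintype.ofFinite G
    rw [Multiset.prod_coe, List.prod_ofFn, Finset.prod_mul_distrib, Finset.prod_inv_distrib,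
      b.prod_comp (fun x => x), c.prod_comp (fun x => x), mul_inv_cancel]
  · intro h
    induction A using Quotient.inductionOn with | h l => ?_
    simp only [Multiset.quot_mk_to_coe, Multiset.coe_card, Multiset.prod_coe] at hA h ⊢
    obtain ⟨b, c, hbc⟩ := exists_equiv_div_eq_of_prod_eq_one (Finite.equivFin G).symm
      (fun i => l.get (i.cast hA.symm)) (by
        rw [← h, ← List.prod_ofFn, List.ofFn_congr hA.symm]
        simp)
    refine ⟨b, c, ?_⟩
    simp only [← div_eq_mul_inv, hbc]
    rw [List.ofFn_congr hA.symm]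
    simp
end

section
/- Let G be a finite group and A a multiset of cardinality |G| with elements in G. Then A is quotient-realizable in G if and only if A admits a cycle-tiling decomposition, i.e., A can be partitioned as a multiset into simple product-one words w₁,...,w_r for which there exist elements x₁,...,x_r ∈ G such that G is the disjoint union of the right translates P(w₁)x₁, ..., P(w_r)x_r. -/
/-- The left partial product `p_j = g_j ⋯ g_2 g_1` of the word `w = (g_1, …, g_ℓ)`;
for `j = 0` this is `1`. -/
def wordPartialProd {G : Type*} [Group G] (w : List G) (j : ℕ) : G :=
  ((w.take j).reverse).prod

/-- A word `w = (g_1, …, g_ℓ)` is a simple product-one word if `p_ℓ = 1` and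
`p_0, p_1, …, p_{ℓ-1}` are pairwise distinct. -/
def IsSimpleProductOneWord {G : Type*} [Group G] (w : List G) : Prop :=
  wordPartialProd w w.length = 1 ∧
  ∀ i j : Fin w.length,
    wordPartialProd w (i : ℕ) = wordPartialProd w (j : ℕ) → i = j

/-- The partial-product set `P(w) = {p_0, p_1, …, p_{ℓ-1}}` of a word `w`. -/
def wordPartialProdSet {G : Type*} [Group G] (w : List G) : Set G :=
  {g | ∃ j : Fin w.length, g = wordPartialProd w (j : ℕ)}

theorem Multiset.coe_list_eq_sum_singleton {α : Type*} (l : List α) :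
    (l : Multiset α) = ∑ i : Fin l.length, ({l[i]} : Multiset α) := by
  induction l with
  | nil => simp
  | cons a l ih =>
    have h := Fin.sum_univ_succ fun i : Fin (l.length + 1) => ({(a :: l)[i]} : Multiset α)
    refine Eq.trans ?_ h.symm
    rw [← Multiset.cons_coe, ih, ← Multiset.singleton_add]
    rfl

theorem Multiset.coe_ofFn_eq_sum_singleton {α : Type*} {n : ℕ} (f : Fin n → α) :
    (List.ofFn f : Multiset α) = ∑ i, ({f i} : Multiset α) := by
  induction n with
  | zero => simp
  | succ n ih =>
    rw [List.ofFn_succ, ← Multiset.cons_coe, ih, ← Multiset.singleton_add, Fin.sum_univ_succ]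

/-- Quotient-realizability in terms of a single permutation `σ`, namely `c i ↦ b i`. -/
theorem quotientRealizable_iff_exists_perm {G : Type*} [Group G] [Fintype G] (A : Multiset G) :
    QuotientRealizable G A ↔
      ∃ σ : Equiv.Perm G, A = ∑ g, ({σ g * g⁻¹} : Multiset G) := by
  constructor
  · rintro ⟨b, c, rfl⟩
    refine ⟨c.symm.trans b, ?_⟩
    rw [Multiset.coe_ofFn_eq_sum_singleton, ← Equiv.sum_comp c]
    simp
  · rintro ⟨σ, rfl⟩
    refine ⟨(Finite.equivFin G).symm.trans σ, (Finite.equivFin G).symm, ?_⟩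
    rw [Multiset.coe_ofFn_eq_sum_singleton, ← Equiv.sum_comp (Finite.equivFin G).symm]
    simp

theorem wordPartialProd_zero {G : Type*} [Group G] (w : List G) : wordPartialProd w 0 = 1 := by
  simp [wordPartialProd]

theorem wordPartialProd_succ {G : Type*} [Group G] (w : List G) (j : ℕ) (hj : j < w.length) :
    wordPartialProd w (j + 1) = w[j] * wordPartialProd w j := by
  rw [wordPartialProd, wordPartialProd, List.take_succ_eq_append_getElem hj, List.reverse_append,
    List.reverse_singleton, List.singleton_append, List.prod_cons]

/-- The partial products of a product-one word satisfy the recursion with cyclic indices. -/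
theorem wordPartialProd_finRotate {G : Type*} [Group G] (w : List G)
    (hw : wordPartialProd w w.length = 1) (i : Fin w.length) :
    wordPartialProd w (finRotate w.length i : Fin w.length) = w[i] * wordPartialProd w i := by
  rw [Fin.getElem_fin, ← wordPartialProd_succ w i i.2]
  generalize w.length = n at hw i
  obtain _ | n := n
  · exact i.elim0
  rcases Fin.eq_castSucc_or_eq_last i with ⟨k, rfl⟩ | rfl
  · rw [finRotate_apply, Fin.coeSucc_eq_succ]
    simp
  · rw [finRotate_last]
    simp [hw, wordPartialProd_zero]

/-- The word of successive quotients along a `σ`-path starting at `x`. -/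
def pathWord {G : Type*} [Group G] (σ : Equiv.Perm G) (x : G) (n : ℕ) : List G :=
  List.ofFn fun i : Fin n => (σ ^ ((i : ℕ) + 1)) x * ((σ ^ (i : ℕ)) x)⁻¹

theorem length_pathWord {G : Type*} [Group G] (σ : Equiv.Perm G) (x : G) (n : ℕ) :
    (pathWord σ x n).length = n := by
  simp [pathWord]

theorem wordPartialProd_pathWord {G : Type*} [Group G] (σ : Equiv.Perm G) (x : G) {n j : ℕ}
    (hj : j ≤ n) : wordPartialProd (pathWord σ x n) j = (σ ^ j) x * x⁻¹ := by
  induction j with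
  | zero => simp [wordPartialProd_zero]
  | succ j ih =>
    rw [wordPartialProd_succ _ _ (by rw [length_pathWord]; omega), ih (by omega)]
    simp [pathWord, mul_assoc]

theorem mem_wordPartialProdSet_pathWord {G : Type*} [Group G] (σ : Equiv.Perm G) (x : G) (n : ℕ)
    (g : G) : (∃ p ∈ wordPartialProdSet (pathWord σ x n), g = p * x) ↔
      ∃ i < n, (σ ^ i) x = g := by
  constructor
  · rintro ⟨p, ⟨j, rfl⟩, rfl⟩
    have hj : (j : ℕ) < n := j.2.trans_eq (length_pathWord σ x n)
    exact ⟨j, hj, by simp [wordPartialProd_pathWord σ x hj.le]⟩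
  · rintro ⟨i, hi, rfl⟩
    exact ⟨_, ⟨⟨i, by rwa [length_pathWord]⟩, rfl⟩, by simp [wordPartialProd_pathWord σ x hi.le]⟩

open Function in
theorem isSimpleProductOneWord_pathWord {G : Type*} [Group G] (σ : Equiv.Perm G) (x : G) :
    IsSimpleProductOneWord (pathWord σ x (minimalPeriod σ x)) := by
  constructor
  · rw [length_pathWord, wordPartialProd_pathWord σ x le_rfl, ← Equiv.Perm.iterate_eq_pow,
      iterate_minimalPeriod, mul_inv_cancel]
  · intro i j h
    have hi : (i : ℕ) < minimalPeriod σ x := i.2.trans_eq (length_pathWord σ x _)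
    have hj : (j : ℕ) < minimalPeriod σ x := j.2.trans_eq (length_pathWord σ x _)
    rw [wordPartialProd_pathWord σ x hi.le, wordPartialProd_pathWord σ x hj.le, mul_left_inj,
      ← Equiv.Perm.iterate_eq_pow, ← Equiv.Perm.iterate_eq_pow] at h
    exact Fin.ext (iterate_injOn_Iio_minimalPeriod hi hj h)

open Function in
theorem Equiv.Perm.sameCycle_iff_exists_lt_minimalPeriod {α : Type*} [Finite α]
    (σ : Equiv.Perm α) (x y : α) :
    σ.SameCycle x y ↔ ∃ i < minimalPeriod σ x, (σ ^ i) x = y := by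
  constructor
  · intro h
    obtain ⟨i, -, -, rfl⟩ := h.exists_pow_eq''
    have hx : 0 < minimalPeriod σ x := minimalPeriod_pos_of_mem_periodicPts
      (σ.injective.mem_periodicPts x)
    refine ⟨i % minimalPeriod σ x, Nat.mod_lt _ hx, ?_⟩
    rw [← iterate_eq_pow, ← iterate_eq_pow, iterate_mod_minimalPeriod_eq]
  · rintro ⟨i, -, rfl⟩
    exact ⟨i, by simp⟩

/-- The cycle-tiling criterion: `A` is quotient-realizable in `G` iff `A` can be
partitioned as a multiset into simple product-one words `w_1, …, w_r` admitting
elements `x_1, …, x_r ∈ G` such that `G` is the disjoint union of the right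
translates `P(w_j)·x_j`. -/
theorem stmt3 {G : Type*} [Group G] [Finite G] (A : Multiset G)
    (hA : Multiset.card A = Nat.card G) :
    QuotientRealizable G A ↔
      ∃ (r : ℕ) (w : Fin r → List G) (x : Fin r → G),
        (∀ j, IsSimpleProductOneWord (w j)) ∧
        A = ∑ j, (↑(w j) : Multiset G) ∧
        ∀ g : G, ∃! j : Fin r, ∃ p ∈ wordPartialProdSet (w j), g = p * x j := by
  have := Fintype.ofFinite G
  rw [quotientRealizable_iff_exists_perm]
  constructor
  · rintro ⟨σ, rfl⟩
    let s := Equiv.Perm.SameCycle.setoid σ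
    let q := Finite.equivFin (Quotient s)
    let x : Fin (Nat.card (Quotient s)) → G := fun j => (q.symm j).out
    have hx (j) (g : G) : σ.SameCycle (x j) g ↔ j = q ⟦g⟧ := by
      rw [← Equiv.symm_apply_eq, ← Quotient.out_eq (q.symm j), Quotient.eq]
      rfl
    let ℓ := fun j => Function.minimalPeriod σ (x j)
    have htile (g : G) : ∃! j, ∃ i < ℓ j, (σ ^ i) (x j) = g := by
      simp only [ℓ, ← Equiv.Perm.sameCycle_iff_exists_lt_minimalPeriod, hx, existsUnique_eq]
    refine ⟨_, fun j => pathWord σ (x j) (ℓ j), x,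
      fun j => isSimpleProductOneWord_pathWord σ (x j), ?_, fun g => ?_⟩
    · have hbij : Function.Bijective
          fun a : Σ j, Fin (ℓ j) => (σ ^ (a.2 : ℕ)) (x a.1) := by
        constructor
        · rintro ⟨j, i⟩ ⟨k, m⟩ h
          obtain rfl : j = k := (htile _).unique ⟨i, i.2, rfl⟩ ⟨m, m.2, h.symm⟩
          simp only [← Equiv.Perm.iterate_eq_pow] at h
          rw [Fin.ext (Function.iterate_injOn_Iio_minimalPeriod i.2 m.2 h)]
        · intro g
          obtain ⟨j, i, hi, h⟩ := (htile g).exists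
          exact ⟨⟨j, i, hi⟩, h⟩
      rw [← (Equiv.ofBijective _ hbij).sum_comp, Fintype.sum_sigma]
      simp [pathWord, Multiset.coe_ofFn_eq_sum_singleton, pow_succ']
    · simpa only [mem_wordPartialProdSet_pathWord] using htile g
  · rintro ⟨r, w, x, hw, rfl, htile⟩
    have hbij : Function.Bijective
        fun a : Σ j, Fin (w j).length => wordPartialProd (w a.1) a.2 * x a.1 := by
      constructor
      · rintro ⟨j, i⟩ ⟨k, m⟩ h
        obtain rfl : j = k := (htile _).unique ⟨_, ⟨i, rfl⟩, rfl⟩ ⟨_, ⟨m, rfl⟩, h⟩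
        rw [(hw j).2 i m (mul_right_cancel h)]
      · intro g
        obtain ⟨j, p, ⟨i, rfl⟩, h⟩ := (htile g).exists
        exact ⟨⟨j, i⟩, h.symm⟩
    let e := Equiv.ofBijective _ hbij
    refine ⟨e.permCongr (Equiv.sigmaCongrRight fun j => finRotate (w j).length), ?_⟩
    rw [← e.sum_comp, Fintype.sum_sigma]
    refine Finset.sum_congr rfl fun j _ => ?_
    rw [Multiset.coe_list_eq_sum_singleton]
    refine Finset.sum_congr rfl fun i _ => ?_
    rw [Equiv.permCongr_apply, Equiv.symm_apply_apply]
    change _ = {wordPartialProd (w j) (finRotate _ i : Fin _) * x j *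
      (wordPartialProd (w j) i * x j)⁻¹}
    rw [wordPartialProd_finRotate _ (hw j).1]
    simp [mul_assoc]
end

section
/- Let s = (12) and t = (23) in S₃. If B is a quotient-realizable multiset of cardinality 6 in S₃ all of whose elements lie in {s, t}, and B contains exactly q copies of s, then q ∈ {0, 3, 6}. -/
/-- The transposition `s = (12)` in `S₃`. -/
def s3s : Equiv.Perm (Fin 3) := Equiv.swap 0 1

/-- The transposition `t = (23)` in `S₃`. -/
def s3t : Equiv.Perm (Fin 3) := Equiv.swap 1 2

/-- A set of elements of `S₃` closed under left multiplication by the 3-cycle `t * s` is a union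
of right cosets of `A₃`. -/
theorem card_of_mul_closed : ∀ P : Finset (Equiv.Perm (Fin 3)),
    (∀ g ∈ P, s3t * s3s * g ∈ P) → P.card = 0 ∨ P.card = 3 ∨ P.card = 6 := by
  unfold s3s s3t
  decide

/-- In a group, let `f` be injective and send each `g` to `s * g` or `t * g`, where `t * t = 1`
and `t * s ≠ 1`. The set where `f g = s * g` is closed under multiplication by `t * s`. -/
theorem apply_mul_mul_eq {G : Type*} [Group G] {s t : G} {f : G → G} (hf : Function.Injective f)
    (ht : t * t = 1) (hts : t * s ≠ 1)
    (hcases : ∀ g, f g = s * g ∨ f g = t * g) {g : G} (hg : f g = s * g) :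
    f (t * s * g) = s * (t * s * g) := by
  refine (hcases _).resolve_right fun h => hts ?_
  have heq : f (t * s * g) = f g := by rw [h, hg, ← mul_assoc, ← mul_assoc, ht, one_mul]
  simpa using hf heq

/-- If a quotient-realizable multiset of cardinality `6` in `S₃` is supported in
`{s, t}` and contains exactly `q` copies of `s`, then `q ∈ {0, 3, 6}`. -/
theorem stmt13 (B : Multiset (Equiv.Perm (Fin 3))) (q : ℕ)
    (hcard : Multiset.card B = 6)
    (hsupp : ∀ g ∈ B, g = s3s ∨ g = s3t)
    (hq : B.count s3s = q)
    (h : QuotientRealizable (Equiv.Perm (Fin 3)) B) :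
    q = 0 ∨ q = 3 ∨ q = 6 := by
  obtain ⟨b, c, rfl⟩ := h
  have hcases (g) : b (c.symm g) = s3s * g ∨ b (c.symm g) = s3t * g := by
    have := hsupp (b (c.symm g) * (c (c.symm g))⁻¹)
      (Multiset.mem_coe.2 (List.mem_ofFn.2 ⟨_, rfl⟩))
    simpa [mul_inv_eq_iff_eq_mul] using this
  have hcount : (Finset.univ.filter fun g => b (c.symm g) = s3s * g).card = q := by
    rw [← hq, ← Fin.univ_val_map, Multiset.count_map, ← Finset.filter_val, Finset.card_val]
    refine Finset.card_equiv c.symm fun g => ?_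
    simp [eq_mul_inv_iff_mul_eq, eq_comm]
  rw [← hcount]
  refine card_of_mul_closed _ fun g hg => ?_
  simp only [Finset.mem_filter, Finset.mem_univ, true_and] at hg ⊢
  exact apply_mul_mul_eq (f := fun g => b (c.symm g)) (b.injective.comp c.symm.injective)
    (by unfold s3t; decide) (by unfold s3s s3t; decide) hcases hg
end

section
/- Let s = (12) and t = (23) in S₃. For each q ∈ {0, 3, 6}, there exists a quotient-realizable multiset of cardinality 6 in S₃, all of whose elements lie in {s, t}, containing exactly q copies of s (and 6 − q copies of t). -/
/-- The quotients `g * (σ g)⁻¹` along a permutation `σ` of a finite group form a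
quotient-realizable multiset. -/
theorem quotientRealizable_map_univ {G : Type*} [Group G] [Fintype G] (σ : Equiv.Perm G) :
    QuotientRealizable G ((Finset.univ : Finset G).val.map fun g => g * (σ g)⁻¹) := by
  refine ⟨(Finite.equivFin G).symm, (Finite.equivFin G).symm.trans σ, ?_⟩
  rw [← Fin.univ_val_map, ← Multiset.map_univ_val_equiv (Finite.equivFin G).symm,
    Multiset.map_map]
  rfl

/-- Left multiplication by `s` on even permutations and by `t` on odd ones: a step along the
`6`-cycle that is the Cayley graph of `S₃` with respect to `{s, t}`. -/
def alternatingStep (g : Equiv.Perm (Fin 3)) : Equiv.Perm (Fin 3) :=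
  if Equiv.Perm.sign g = 1 then s3s * g else s3t * g

theorem alternatingStep_bijective : Function.Bijective alternatingStep :=
  Finite.injective_iff_bijective.mp (by decide +kernel)

/-- For each `q ∈ {0, 3, 6}` there is a quotient-realizable multiset of cardinality
`6` in `S₃`, supported in `{s, t}`, with exactly `q` copies of `s` and `6 - q`
copies of `t`. -/
theorem stmt14 :
    ∀ q ∈ ({0, 3, 6} : Set ℕ),
      ∃ B : Multiset (Equiv.Perm (Fin 3)),
        Multiset.card B = 6 ∧
        (∀ g ∈ B, g = s3s ∨ g = s3t) ∧
        B.count s3s = q ∧ B.count s3t = 6 - q ∧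
        QuotientRealizable (Equiv.Perm (Fin 3)) B := by
  rintro q (rfl | rfl | rfl)
  · refine ⟨_, ?_, ?_, ?_, ?_, quotientRealizable_map_univ (Equiv.mulLeft s3t)⟩ <;>
      decide +kernel
  · refine ⟨_, ?_, ?_, ?_, ?_, quotientRealizable_map_univ
      (Equiv.ofBijective alternatingStep alternatingStep_bijective)⟩ <;> decide +kernel
  · refine ⟨_, ?_, ?_, ?_, ?_, quotientRealizable_map_univ (Equiv.mulLeft s3s)⟩ <;>
      decide +kernel
end

section
/- Let K be a finite group with 3 ∤ |K|, let G = S₃ × K, and set s' = ((12), 1_K) and t' = ((23), 1_K). Let A be the multiset in G consisting of 2|K| copies of s' and 4|K| copies of t'. Then A is not quotient-realizable in G. -/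
/-- Let `s` and `t` be elements of a finite group such that `t² = 1` and `t * s` has order three. If
every quotient `b i * (c i)⁻¹` of two enumerations lies in `{s, t}`, then the number of times the
quotient equals `s` is a multiple of three. -/
theorem three_dvd_card_quotient_eq {ι G : Type*} [Fintype ι] [Group G] [DecidableEq G]
    (b c : ι ≃ G) {s t : G} (hts : t * s ≠ 1) (htt : t * t = 1) (h3 : (t * s) ^ 3 = 1)
    (h : ∀ i, b i * (c i)⁻¹ = s ∨ b i * (c i)⁻¹ = t) :
    3 ∣ Fintype.card {i // b i * (c i)⁻¹ = s} := by
  have step (i : ι) (hi : b i * (c i)⁻¹ = s) :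
      b (c.symm (t * s * c i)) * (c (c.symm (t * s * c i)))⁻¹ = s := by
    refine (h _).resolve_right fun ht ↦ hts ?_
    rw [mul_inv_eq_iff_eq_mul] at hi ht
    have hb : b (c.symm (t * s * c i)) = b i := by
      rw [ht, hi, Equiv.apply_symm_apply, ← mul_assoc, ← mul_assoc, htt, one_mul]
    have hc := c.symm_apply_eq.mp (b.injective hb)
    exact mul_eq_right.mp hc
  let f : Function.End {i // b i * (c i)⁻¹ = s} := fun i ↦ ⟨c.symm (t * s * c i), step i i.2⟩
  have hf (i) : c (f i).1 = t * s * c i := c.apply_symm_apply _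
  have hf3 : f ^ 3 ^ 1 = 1 := by
    funext i
    apply Subtype.ext
    apply c.injective
    change c (f (f (f i))).1 = c i.1
    rw [hf, hf, hf, ← mul_assoc, ← mul_assoc, ← pow_two, ← pow_succ, h3, one_mul]
  have : IsEmpty f.fixedPoints := ⟨fun ⟨i, hi⟩ ↦ hts <| mul_eq_right.mp <|
    (hf i).symm.trans (congrArg (fun j ↦ c j.1) hi)⟩
  have : Fact (Nat.Prime 3) := ⟨Nat.prime_three⟩
  classical
  have hcard := Equiv.Perm.card_fixedPoints_modEq hf3
  rw [Fintype.card_eq_zero (α := f.fixedPoints)] at hcard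
  exact (Nat.modEq_zero_iff_dvd).mp hcard

/-- Let `K` be a finite group with `3 ∤ |K|` and `G = S₃ × K`.  The multiset
consisting of `2|K|` copies of `s' = ((12), 1)` and `4|K|` copies of
`t' = ((23), 1)` is not quotient-realizable in `G`. -/
theorem stmt15 (K : Type*) [Group K] [Finite K] (hK : ¬ (3 ∣ Nat.card K)) :
    ¬ QuotientRealizable (Equiv.Perm (Fin 3) × K)
        (Multiset.replicate (2 * Nat.card K) (Equiv.swap 0 1, (1 : K)) +
         Multiset.replicate (4 * Nat.card K) (Equiv.swap 1 2, (1 : K))) := by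
  classical
  rintro ⟨b, c, hA⟩
  rw [← Fin.univ_val_map] at hA
  have hne : ((Equiv.swap 1 2 : Equiv.Perm (Fin 3)), (1 : K)) ≠ (Equiv.swap 0 1, 1) :=
    fun h ↦ absurd (congrArg Prod.fst h)
      (by decide : (Equiv.swap 1 2 : Equiv.Perm (Fin 3)) ≠ Equiv.swap 0 1)
  have hdvd := three_dvd_card_quotient_eq b c
    (s := ((Equiv.swap 0 1 : Equiv.Perm (Fin 3)), (1 : K))) (t := (Equiv.swap 1 2, 1))
    (fun h ↦ absurd (congrArg Prod.fst h)
      (by decide : (Equiv.swap 1 2 : Equiv.Perm (Fin 3)) * Equiv.swap 0 1 ≠ 1))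
    (Prod.ext (by decide : (Equiv.swap 1 2 : Equiv.Perm (Fin 3)) * Equiv.swap 1 2 = 1) (by simp))
    (Prod.ext (by decide : ((Equiv.swap 1 2 : Equiv.Perm (Fin 3)) * Equiv.swap 0 1) ^ 3 = 1)
      (by simp)) fun i ↦ by
      have hi := Multiset.mem_map_of_mem (fun i ↦ b i * (c i)⁻¹) (Finset.mem_univ_val i)
      rw [← hA, Multiset.mem_add] at hi
      exact hi.imp Multiset.eq_of_mem_replicate Multiset.eq_of_mem_replicate
  have hcount := congrArg (Multiset.count (Equiv.swap 0 1, (1 : K))) hA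
  rw [Multiset.count_add, Multiset.count_replicate_self, Multiset.count_replicate, if_neg hne,
    Multiset.count_map] at hcount
  simp only [eq_comm (a := ((Equiv.swap 0 1 : Equiv.Perm (Fin 3)), (1 : K)))] at hcount
  rw [← Finset.filter_val, Finset.card_val, ← Fintype.card_subtype] at hcount
  rw [← hcount] at hdvd
  omega
end

section
/- There exists a finite nonabelian group G and a multiset A of cardinality |G| with elements in G such that A satisfies the abelianization obstruction (the product of the images of its elements in the abelianization of G is trivial), the elements of A admit an ordering whose product in G is 1, and yet A is not quotient-realizable in G. -/
/-- Rewriting of quotient-realizability through the permutation `σ` with `σ (c i) = b i`. -/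
theorem QuotientRealizable.exists_perm {G : Type*} [Group G] [Fintype G] {A : Multiset G}
    (h : QuotientRealizable G A) :
    ∃ σ : Equiv.Perm G, A = Finset.univ.val.map fun x => σ x * x⁻¹ := by
  obtain ⟨b, c, rfl⟩ := h
  refine ⟨c.symm.trans b, ?_⟩
  rw [← Finset.map_univ_equiv c, Finset.map_val, Multiset.map_map]
  simp [Fin.univ_val_map]

/-- If `a⁻¹ * b` has order at least three, a multiset consisting of copies of `a` and exactly
two copies of `b` is not quotient-realizable. -/
theorem not_quotientRealizable_of_count_eq_two {G : Type*} [Group G] [Fintype G] [DecidableEq G]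
    {A : Multiset G} {a b : G} (hA : ∀ g ∈ A, g = a ∨ g = b) (hcount : A.count b = 2)
    (hab : a⁻¹ * b ≠ 1) (hab2 : (a⁻¹ * b) * (a⁻¹ * b) ≠ 1) : ¬ QuotientRealizable G A := by
  intro h
  obtain ⟨σ, rfl⟩ := h.exists_perm
  set t := a⁻¹ * b with ht
  have hσ : ∀ x, σ x * x⁻¹ = a ∨ σ x * x⁻¹ = b := fun x =>
    hA _ (Multiset.mem_map_of_mem _ (Finset.mem_univ x))
  let S : Finset G := {x | b = σ x * x⁻¹}
  have hS : S.card = 2 := by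
    rw [Multiset.count_map] at hcount
    exact hcount
  have hstep : ∀ x ∈ S, t * x ∈ S := by
    intro x hx
    have hx' : b = σ x * x⁻¹ := by simpa [S] using hx
    rcases hσ (t * x) with h1 | h1
    · exfalso
      have h2 : σ (t * x) = σ x := by
        rw [eq_mul_inv_iff_mul_eq] at hx'
        rw [mul_inv_eq_iff_eq_mul] at h1
        rw [h1, ← hx', ht]
        group
      exact hab (mul_eq_right.mp (σ.injective h2))
    · simpa [S] using h1.symm
  obtain ⟨x, hx⟩ : S.Nonempty := Finset.card_pos.mp (by omega)
  have hsub : ({x, t * x, t * (t * x)} : Finset G) ⊆ S := by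
    simp only [Finset.insert_subset_iff, Finset.singleton_subset_iff]
    exact ⟨hx, hstep _ hx, hstep _ (hstep _ hx)⟩
  have hcard : ({x, t * x, t * (t * x)} : Finset G).card = 3 := by
    refine Finset.card_eq_three.mpr ⟨_, _, _, ?_, ?_, ?_, rfl⟩
    · simpa using hab
    · simpa [← mul_assoc] using hab2
    · simpa using hab
  have := Finset.card_le_card hsub
  omega

/-- There is a finite nonabelian group `G` and a multiset `A` of cardinality `|G|`
in `G` which satisfies the abelianization obstruction and admits an ordering with
product `1`, but is not quotient-realizable in `G`. -/
theorem stmt17 :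
    ∃ (G : Type) (_ : Group G) (_ : Finite G) (A : Multiset G),
      (∃ a b : G, a * b ≠ b * a) ∧
      Multiset.card A = Nat.card G ∧
      (A.map (fun g => Abelianization.of g)).prod = 1 ∧
      (∃ l : List G, A = ↑l ∧ l.prod = 1) ∧
      ¬ QuotientRealizable G A := by
  let a : Equiv.Perm (Fin 3) := Equiv.swap 0 1
  let b : Equiv.Perm (Fin 3) := Equiv.swap 1 2
  have hl : [a, a, a, a, b, b].prod = 1 := by decide
  refine ⟨Equiv.Perm (Fin 3), inferInstance, inferInstance, ↑[a, a, a, a, b, b],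
    ⟨a, b, by decide⟩, ?_, ?_, ⟨_, rfl, hl⟩, ?_⟩
  · simp [Fintype.card_perm, Nat.factorial]
  · rw [Multiset.map_coe, Multiset.prod_coe, List.prod_hom, hl, map_one]
  · refine not_quotientRealizable_of_count_eq_two (a := a) (b := b) ?_ ?_ ?_ ?_
    · simp
    · decide
    · decide
    · decide
end

section
/- For every natural number N there exists a finite nonabelian group G with |G| > N and a multiset A of cardinality |G| with elements in G such that: (i) A satisfies the abelianization obstruction (the product of the images of its elements in the abelianization of G is trivial); (ii) the elements of A admit an ordering whose product in G is 1; and (iii) A is not quotient-realizable in G. In particular, infinitely many finite nonabelian groups admit such a multiset; for example G = S₃ × C_m for any m with 3 ∤ m works. -/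
/-- In a multiset of left quotients of two enumerations of `G`, if all but two members equal `z`,
then the two exceptional members `x`, `y` satisfy `z⁻¹ * y * (z⁻¹ * x) = 1`: left translation by
`z⁻¹` turns the underlying permutation into one moving at most two points. -/
theorem QuotientRealizable.inv_mul_mul_inv_mul_eq_one {G : Type*} [Group G] {k : ℕ} {x y z : G}
    (h : QuotientRealizable G (x ::ₘ y ::ₘ Multiset.replicate k z)) :
    z⁻¹ * y * (z⁻¹ * x) = 1 := by
  classical
  obtain ⟨b, c, h⟩ := h
  set f : Fin (Nat.card G) → G := fun i => b i * (c i)⁻¹ with hf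
  have hA : (Finset.univ.val.map f) = x ::ₘ y ::ₘ Multiset.replicate k z := by
    rw [h, Fin.univ_val_map]
  obtain ⟨i, -, hi⟩ : ∃ i ∈ Finset.univ.val, f i = x := by
    rw [← Multiset.mem_map, hA]; simp
  rw [← Multiset.cons_erase (Finset.mem_univ_val i), Multiset.map_cons, hi,
    Multiset.cons_inj_right] at hA
  obtain ⟨j, hj, hjy⟩ : ∃ j ∈ Finset.univ.val.erase i, f j = y := by
    rw [← Multiset.mem_map, hA]; simp
  rw [← Multiset.cons_erase hj, Multiset.map_cons, hjy, Multiset.cons_inj_right] at hA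
  have hrest : ∀ l, l ≠ i → l ≠ j → b l = z * c l := by
    intro l hli hlj
    have hl : f l ∈ ((Finset.univ.val.erase i).erase j).map f :=
      Multiset.mem_map_of_mem f <| (Multiset.mem_erase_of_ne hlj).2 <|
        (Multiset.mem_erase_of_ne hli).2 <| Finset.mem_univ_val l
    rw [hA] at hl
    exact eq_mul_of_mul_inv_eq (Multiset.eq_of_mem_replicate hl)
  have hij : i ≠ j := by
    rintro rfl
    exact (Multiset.Nodup.notMem_erase Finset.univ.nodup) hj
  have hbi : b i = x * c i := eq_mul_of_mul_inv_eq hi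
  have hbj : b j = y * c j := eq_mul_of_mul_inv_eq hjy
  -- the preimages under `b` of the two values missed by the unexceptional indices
  have key : ∀ u, u = i ∨ u = j → ∃ v, (v = i ∨ v = j) ∧ b v = z * c u := by
    intro u hu
    refine ⟨b.symm (z * c u), ?_, by simp⟩
    by_contra hv
    rw [not_or] at hv
    have := hrest _ hv.1 hv.2
    rw [Equiv.apply_symm_apply, mul_right_inj, c.apply_eq_iff_eq] at this
    rw [← this] at hv
    tauto
  obtain ⟨v, hv, hvi⟩ := key i (Or.inl rfl)
  obtain ⟨w, hw, hwj⟩ := key j (Or.inr rfl)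
  have hvw : v ≠ w := by
    rintro rfl
    rw [hvi, mul_right_inj, c.apply_eq_iff_eq] at hwj
    exact hij hwj
  rcases hv with rfl | rfl <;> rcases hw with rfl | rfl
  · exact absurd rfl hvw
  · rw [hbi, mul_left_inj] at hvi
    rw [hbj, mul_left_inj] at hwj
    simp [hvi, hwj]
  · have hx : z⁻¹ * x * c w = c v := by rw [mul_assoc, ← hbi, hwj]; simp
    have hy : z⁻¹ * y * c v = c w := by rw [mul_assoc, ← hbj, hvi]; simp
    have : z⁻¹ * y * (z⁻¹ * x) * c w = c w := by rw [mul_assoc, hx, hy]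
    simpa using this
  · exact absurd rfl hvw

/-- A multiset with an ordering of product `1` has trivial product in the abelianization. -/
theorem prod_map_abelianizationOf_coe_eq_one {G : Type*} [Group G] {l : List G}
    (hl : l.prod = 1) : ((l : Multiset G).map fun g => Abelianization.of g).prod = 1 := by
  rw [Multiset.map_coe, Multiset.prod_coe, ← map_list_prod, hl, map_one]

theorem card_perm_three_prod_zmod (m : ℕ) :
    Nat.card (Equiv.Perm (Fin 3) × Multiplicative (ZMod m)) = 6 * m := by
  rw [Nat.card_prod, Nat.card_perm, Nat.card_fin]
  simp [Nat.factorial, Nat.card_congr Multiplicative.toAdd]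

/-- With `s = (0 1)` and `t = (1 2)` in `S₃`, the multiset consisting of `s`, `t` and `6 * m - 2`
copies of `t * s` in `S₃ × C_m` has an ordering of product `1` but is not quotient-realizable. -/
theorem exists_not_quotientRealizable_perm_three_prod_zmod {m : ℕ} (hm : 0 < m) :
    (∃ a b : Equiv.Perm (Fin 3) × Multiplicative (ZMod m), a * b ≠ b * a) ∧
      ∃ A : Multiset (Equiv.Perm (Fin 3) × Multiplicative (ZMod m)),
        Multiset.card A = Nat.card (Equiv.Perm (Fin 3) × Multiplicative (ZMod m)) ∧
        (A.map (fun g => Abelianization.of g)).prod = 1 ∧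
        (∃ l : List (Equiv.Perm (Fin 3) × Multiplicative (ZMod m)), A = ↑l ∧ l.prod = 1) ∧
        ¬ QuotientRealizable (Equiv.Perm (Fin 3) × Multiplicative (ZMod m)) A := by
  let ι := MonoidHom.inl (Equiv.Perm (Fin 3)) (Multiplicative (ZMod m))
  have hι : Function.Injective ι := fun a b h => congrArg Prod.fst h
  let s : Equiv.Perm (Fin 3) := Equiv.swap 0 1
  let t : Equiv.Perm (Fin 3) := Equiv.swap 1 2
  obtain ⟨n, rfl⟩ : ∃ n, m = n + 1 := ⟨m - 1, by omega⟩
  let L := ι s :: ι t :: List.replicate (6 * n + 4) (ι (t * s))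
  have hL : L.prod = 1 := by
    have h1 : (t * s) ^ 6 = 1 := by decide
    have h2 : s * (t * (t * s) ^ 4) = 1 := by decide
    simp only [L, List.prod_cons, List.prod_replicate, ← map_pow, ← map_mul]
    rw [pow_add, pow_mul, h1, one_pow, one_mul, h2, map_one]
  refine ⟨⟨ι s, ι t, ?_⟩, L, ?_, prod_map_abelianizationOf_coe_eq_one hL, ⟨L, rfl, hL⟩, ?_⟩
  · rw [← map_mul, ← map_mul]
    exact hι.ne (by decide)
  · rw [card_perm_three_prod_zmod]
    simp [L]
    ring
  · intro h
    have := QuotientRealizable.inv_mul_mul_inv_mul_eq_one h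
    simp only [← map_inv, ← map_mul] at this
    exact absurd (hι (this.trans (map_one ι).symm)) (by decide)

/-- For every `N` there is a finite nonabelian group `G` of order greater than `N`
together with a multiset `A` of cardinality `|G|` in `G` which satisfies the
abelianization obstruction and admits an ordering with product `1`, but is not
quotient-realizable in `G`.  In particular infinitely many finite nonabelian groups
admit such a multiset; for example every `G = S₃ × C_m` with `3 ∤ m` works. -/
theorem stmt18 :
    (∀ N : ℕ, ∃ (G : Type) (_ : Group G) (_ : Finite G),
      N < Nat.card G ∧
      (∃ a b : G, a * b ≠ b * a) ∧
      ∃ A : Multiset G,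
        Multiset.card A = Nat.card G ∧
        (A.map (fun g => Abelianization.of g)).prod = 1 ∧
        (∃ l : List G, A = ↑l ∧ l.prod = 1) ∧
        ¬ QuotientRealizable G A) ∧
    (∀ m : ℕ, 0 < m → ¬ (3 ∣ m) →
      (∃ a b : Equiv.Perm (Fin 3) × Multiplicative (ZMod m), a * b ≠ b * a) ∧
      ∃ A : Multiset (Equiv.Perm (Fin 3) × Multiplicative (ZMod m)),
        Multiset.card A = Nat.card (Equiv.Perm (Fin 3) × Multiplicative (ZMod m)) ∧
        (A.map (fun g => Abelianization.of g)).prod = 1 ∧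
        (∃ l : List (Equiv.Perm (Fin 3) × Multiplicative (ZMod m)), A = ↑l ∧ l.prod = 1) ∧
        ¬ QuotientRealizable (Equiv.Perm (Fin 3) × Multiplicative (ZMod m)) A) := by
  refine ⟨fun N => ?_, fun m hm _ => exists_not_quotientRealizable_perm_three_prod_zmod hm⟩
  refine ⟨Equiv.Perm (Fin 3) × Multiplicative (ZMod (N + 1)), inferInstance, inferInstance, ?_,
    exists_not_quotientRealizable_perm_three_prod_zmod N.succ_pos⟩
  rw [card_perm_three_prod_zmod]
  omega
end
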